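/- With M₀ the explicit 8×8 skew-symmetric matrix of linear forms in ℂ[x₁,...,x₅] given below, for 0 ≤ i < j ≤ 7 let Pf_{ij}(M₀) denote the Pfaffian of the 6×6 skew-symmetric matrix obtained from M₀ by deleting the i-th and j-th rows and the i-th and j-th columns (a homogeneous cubic polynomial). Then the 140 homogeneous quartic polynomials x_k · Pf_{ij}(M₀), for 1 ≤ k ≤ 5 and 0 ≤ i < j ≤ 7, span the entire 70-dimensional ℂ-vector space of homogeneous polynomials of degree 4 in x₁,...,x₅. (This says that the Pfaffian map from 8×8 skew-symmetric matrices of linear forms to quinary quartics has surjective differential at M₀.) -/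

import Mathlib

/-!
The explicit Pfaffian representation of a particular quartic threefold
(Proposition 2.2 of Iliev–Markushevich, "Quartic 3-fold: Pfaffians, vector
bundles, and half-canonical curves").  `M₀` is an explicit `8×8` skew-symmetric
matrix of linear forms in `ℂ[x₁, …, x₅]` (the variables being `X 0, …, X 4`)
and `F₀ = Pf(M₀)` the corresponding quartic.
-/

noncomputable section

open MvPolynomial Matrix

/-- The Pfaffian of a `2n × 2n` matrix over a `ℚ`-algebra, by the standard
averaged formula `Pf(A) = (2ⁿ n!)⁻¹ ∑_σ sgn(σ) ∏ᵢ A_{σ(2i), σ(2i+1)}`.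
For a skew-symmetric matrix this is the canonical square root of the
determinant, normalized so that the Pfaffian of the standard symplectic matrix
is `1`. -/
def pfaffian {R : Type*} [CommRing R] [Algebra ℚ R] {n : ℕ}
    (A : Matrix (Fin (2 * n)) (Fin (2 * n)) R) : R :=
  algebraMap ℚ R ((2 ^ n * n.factorial : ℚ)⁻¹) *
    ∑ σ : Equiv.Perm (Fin (2 * n)),
      (Equiv.Perm.sign σ : ℤ) •
        ∏ i : Fin n,
          A (σ ⟨2 * i.1, by have := i.2; omega⟩) (σ ⟨2 * i.1 + 1, by have := i.2; omega⟩)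

/-- The polynomial ring `ℂ[x₁, …, x₅]`; the variable `xᵢ` of the paper is
`X (i-1)` here. -/
abbrev P5 : Type := MvPolynomial (Fin 5) ℂ

/-- `x₁` -/ abbrev x1 : P5 := X 0
/-- `x₂` -/ abbrev x2 : P5 := X 1
/-- `x₃` -/ abbrev x3 : P5 := X 2
/-- `x₄` -/ abbrev x4 : P5 := X 3
/-- `x₅` -/ abbrev x5 : P5 := X 4

/-- The explicit `8×8` skew-symmetric matrix `M₀` of linear forms of the
paper. -/
def M₀ : Matrix (Fin 8) (Fin 8) P5 :=
  Matrix.of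
    ![![0,   x1,  x2,  x3,  x4,  x5,  x1,  0],
      ![-x1, 0,   0,   x5,  0,   0,   -x3, -x1],
      ![-x2, 0,   0,   x1,  x1,  0,   0,   -x4],
      ![-x3, -x5, -x1, 0,   x2,  0,   0,   0],
      ![-x4, 0,   -x1, -x2, 0,   x3,  x1,  0],
      ![-x5, 0,   0,   0,   -x3, 0,   x4,  x2],
      ![-x1, x3,  0,   0,   -x1, -x4, 0,   x5],
      ![0,   x1,  x4,  0,   0,   -x2, -x5, 0]]

/-- The explicit quartic form `F₀ = Pf(M₀)` of the paper. -/
def F₀ : P5 :=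
  x1^3*x2 - x1^3*x3 + x2^3*x3 - x1*x2*x3^2 - x1*x2^2*x4 + x1^2*x3*x4
    + x1*x2*x3*x4 + x3^3*x4 - x1^2*x4^2 + x1*x2*x4^2 + x1^3*x5 - x1^2*x2*x5
    - x1*x2^2*x5 - x1^2*x3*x5 + x1*x3*x4*x5 + x2*x3*x4*x5 + x4^3*x5
    + x2*x3*x5^2 - x1*x4*x5^2 + x1*x5^3

/-- The signed sum of `F` over all rearrangements of the tuple `g`. -/
def signedSum {R α : Type*} [AddCommGroup R] {n : ℕ} (F : (Fin n → α) → R) (g : Fin n → α) : R :=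
  ∑ σ : Equiv.Perm (Fin n), (Equiv.Perm.sign σ : ℤ) • F (g ∘ σ)

open Equiv.Perm in
theorem signedSum_cons {R α : Type*} [AddCommGroup R] {n : ℕ}
    (F : (Fin (n + 1) → α) → R) (a : α) (t : Fin n → α) :
    signedSum F (Matrix.vecCons a t) = signedSum (fun h => F (Matrix.vecCons a h)) t -
      ∑ i, signedSum (fun h => F (Matrix.vecCons (t i) h)) (Function.update t i a) := by
  unfold signedSum
  rw [← decomposeFin.symm.sum_comp, Fintype.sum_prod_type, Fin.sum_univ_succ, sub_eq_add_neg,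
    ← Finset.sum_neg_distrib]
  have hcomp (i : Fin (n + 1)) (τ : Equiv.Perm (Fin n)) :
      Matrix.vecCons a t ∘ decomposeFin.symm (i, τ) = Matrix.vecCons (Matrix.vecCons a t i)
        ((fun j => Matrix.vecCons a t (Equiv.swap 0 i j.succ)) ∘ τ) := by
    funext j
    refine Fin.cases ?_ (fun j => ?_) j <;> simp
  have hswap (i : Fin n) :
      (fun j : Fin n => Matrix.vecCons a t (Equiv.swap 0 i.succ j.succ)) =
        Function.update t i a := by
    funext j
    by_cases hj : j = i <;> simp [Equiv.swap_apply_def, hj]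
  congr 1
  · simp [hcomp, decomposeFin.symm_sign]
  · simp [hcomp, hswap, decomposeFin.symm_sign, ← Finset.sum_neg_distrib]

section
variable {R α : Type*} [AddCommGroup R]

theorem signedSum_two (F : (Fin 2 → α) → R) (a b : α) :
    signedSum F ![a, b] = F ![a, b] - F ![b, a] := by
  have h1 (G : (Fin 1 → α) → R) (x : Fin 1 → α) : signedSum G x = G x := by
    simp [signedSum, Equiv.Perm.default_eq]
  rw [signedSum_cons, Fin.sum_univ_one, h1, h1]
  congr
  funext j
  fin_cases j
  rfl

theorem signedSum_three (F : (Fin 3 → α) → R) (a b c : α) :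
    signedSum F ![a, b, c] = signedSum (fun h => F (Matrix.vecCons a h)) ![b, c]
      - signedSum (fun h => F (Matrix.vecCons b h)) ![a, c]
      - signedSum (fun h => F (Matrix.vecCons c h)) ![b, a] := by
  rw [signedSum_cons (n := 2), Fin.sum_univ_two]
  simp only [sub_sub]
  congr <;> funext j <;> fin_cases j <;> rfl

theorem signedSum_four (F : (Fin 4 → α) → R) (a b c d : α) :
    signedSum F ![a, b, c, d] = signedSum (fun h => F (Matrix.vecCons a h)) ![b, c, d]
      - signedSum (fun h => F (Matrix.vecCons b h)) ![a, c, d]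
      - signedSum (fun h => F (Matrix.vecCons c h)) ![b, a, d]
      - signedSum (fun h => F (Matrix.vecCons d h)) ![b, c, a] := by
  rw [signedSum_cons (n := 3), Fin.sum_univ_three]
  simp only [sub_sub]
  congr <;> funext j <;> fin_cases j <;> rfl

theorem signedSum_five (F : (Fin 5 → α) → R) (a b c d e : α) :
    signedSum F ![a, b, c, d, e] = signedSum (fun h => F (Matrix.vecCons a h)) ![b, c, d, e]
      - signedSum (fun h => F (Matrix.vecCons b h)) ![a, c, d, e]
      - signedSum (fun h => F (Matrix.vecCons c h)) ![b, a, d, e]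
      - signedSum (fun h => F (Matrix.vecCons d h)) ![b, c, a, e]
      - signedSum (fun h => F (Matrix.vecCons e h)) ![b, c, d, a] := by
  rw [signedSum_cons (n := 4), Fin.sum_univ_four]
  simp only [sub_sub]
  congr <;> funext j <;> fin_cases j <;> rfl

theorem signedSum_six (F : (Fin 6 → α) → R) (a b c d e f : α) :
    signedSum F ![a, b, c, d, e, f] = signedSum (fun h => F (Matrix.vecCons a h)) ![b, c, d, e, f]
      - signedSum (fun h => F (Matrix.vecCons b h)) ![a, c, d, e, f]
      - signedSum (fun h => F (Matrix.vecCons c h)) ![b, a, d, e, f]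
      - signedSum (fun h => F (Matrix.vecCons d h)) ![b, c, a, e, f]
      - signedSum (fun h => F (Matrix.vecCons e h)) ![b, c, d, a, f]
      - signedSum (fun h => F (Matrix.vecCons f h)) ![b, c, d, e, a] := by
  rw [signedSum_cons (n := 5), Fin.sum_univ_five]
  simp only [sub_sub]
  congr <;> funext j <;> fin_cases j <;> rfl

end

theorem signedSum_four_mul {R α : Type*} [CommRing R] (A : α → α → R)
    (hA : ∀ i j, A j i = -A i j) (r : R) (a b c d : α) :
    signedSum (fun h => r * A (h 0) (h 1) * A (h 2) (h 3)) ![a, b, c, d] =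
      8 * r * (A a b * A c d - A a c * A b d + A a d * A b c) := by
  simp only [signedSum_four, signedSum_three, signedSum_two, Matrix.cons_val]
  rw [hA a b, hA a c, hA a d, hA b c, hA b d, hA c d]
  ring

theorem signedSum_six_mul {R α : Type*} [CommRing R] (A : α → α → R)
    (hA : ∀ i j, A j i = -A i j) (a b c d e f : α) :
    signedSum (fun h => A (h 0) (h 1) * A (h 2) (h 3) * A (h 4) (h 5)) ![a, b, c, d, e, f] =
      48 * (A a b * (A c d * A e f - A c e * A d f + A c f * A d e)
        - A a c * (A b d * A e f - A b e * A d f + A b f * A d e)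
        + A a d * (A b c * A e f - A b e * A c f + A b f * A c e)
        - A a e * (A b c * A d f - A b d * A c f + A b f * A c d)
        + A a f * (A b c * A d e - A b d * A c e + A b e * A c d)) := by
  simp only [signedSum_six, signedSum_five, Matrix.cons_val, signedSum_four_mul A hA]
  rw [hA a b, hA a c, hA a d, hA a e, hA a f, hA b c, hA b d, hA b e, hA b f, hA c d, hA c e,
    hA c f, hA d e, hA d f, hA e f]
  ring

theorem pfaffian_six {R : Type*} [CommRing R] [Algebra ℚ R] (A : Matrix (Fin 6) (Fin 6) R)
    (hA : ∀ i j, A j i = -A i j) :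
    pfaffian (n := 3) A =
      A 0 1 * (A 2 3 * A 4 5 - A 2 4 * A 3 5 + A 2 5 * A 3 4)
      - A 0 2 * (A 1 3 * A 4 5 - A 1 4 * A 3 5 + A 1 5 * A 3 4)
      + A 0 3 * (A 1 2 * A 4 5 - A 1 4 * A 2 5 + A 1 5 * A 2 4)
      - A 0 4 * (A 1 2 * A 3 5 - A 1 3 * A 2 5 + A 1 5 * A 2 3)
      + A 0 5 * (A 1 2 * A 3 4 - A 1 3 * A 2 4 + A 1 4 * A 2 3) := by
  have hid (i : Fin 6) : ![0, 1, 2, 3, 4, 5] i = i := by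
    fin_cases i <;> rfl
  have key := signedSum_six_mul A hA 0 1 2 3 4 5
  simp only [signedSum, Function.comp_apply, hid] at key
  have h48 : algebraMap ℚ R ((2 ^ 3 * (3 : ℕ).factorial : ℚ)⁻¹) * 48 = 1 := by
    rw [show (48 : R) = algebraMap ℚ R 48 from (map_ofNat _ 48).symm, ← map_mul]
    rw [show ((2 ^ 3 * (3 : ℕ).factorial : ℚ)⁻¹) * 48 = 1 by norm_num [Nat.factorial], map_one]
  rw [pfaffian]
  simp only [Fin.prod_univ_three]
  refine (congrArg _ key).trans ?_
  rw [← mul_assoc, h48, one_mul]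

set_option maxHeartbeats 2000000 in
/-- A family of numbers indexed by exponents that is annihilated by all degree-one multiples of the
`6 × 6` Pfaffians of `M₀` vanishes in degree four. -/
theorem eq_zero_of_cubic_relations (m : ℕ → ℕ → ℕ → ℕ → ℕ → ℂ)
    (p01 : ∀ a b c d e, a + b + c + d + e = 1 →
      m (a + 1) b (c + 1) d (e + 1) - m (a + 2) (b + 1) c d e - m a (b + 1) c (d + 2) e = 0)
    (p02 : ∀ a b c d e, a + b + c + d + e = 1 →
      m a (b + 2) (c + 1) d e + m a b (c + 1) d (e + 2) - m (a + 1) (b + 1) c (d + 1) e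
        - m (a + 1) (b + 1) c d (e + 1) = 0)
    (p03 : ∀ a b c d e, a + b + c + d + e = 1 →
      m (a + 1) (b + 1) (c + 1) d e - m (a + 2) b c (d + 1) e - m a b (c + 2) (d + 1) e = 0)
    (p04 : ∀ a b c d e, a + b + c + d + e = 1 →
      m (a + 1) (b + 1) (c + 1) d e + m a b c (d + 2) (e + 1) - m (a + 2) b c (d + 1) e = 0)
    (p05 : ∀ a b c d e, a + b + c + d + e = 1 →
      m (a + 1) b c (d + 1) (e + 1) - m (a + 3) b c d e - m (a + 1) b c d (e + 2)
        - m a (b + 1) (c + 1) (d + 1) e = 0)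
    (p06 : ∀ a b c d e, a + b + c + d + e = 1 →
      m a b (c + 1) (d + 1) (e + 1) - m (a + 2) b (c + 1) d e - m (a + 1) (b + 1) c d (e + 1) = 0)
    (p07 : ∀ a b c d e, a + b + c + d + e = 1 →
      -m (a + 1) b (c + 2) d e - m (a + 1) b c (d + 1) (e + 1) = 0)
    (p12 : ∀ a b c d e, a + b + c + d + e = 1 →
      m a (b + 1) c d (e + 2) + m a b (c + 2) d (e + 1) - m (a + 1) (b + 2) c d e
        - m (a + 1) (b + 1) (c + 1) d e = 0)
    (p13 : ∀ a b c d e, a + b + c + d + e = 1 →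
      m (a + 1) b (c + 1) (d + 1) e + m (a + 1) b c d (e + 2) + m a (b + 1) (c + 1) d (e + 1)
        + m a b c (d + 3) e - m (a + 2) (b + 1) c d e - m (a + 1) (b + 2) c d e
        - m (a + 1) b c (d + 1) (e + 1) = 0)
    (p14 : ∀ a b c d e, a + b + c + d + e = 1 →
      m (a + 1) b c d (e + 2) + m a b (c + 1) (d + 2) e - m (a + 2) (b + 1) c d e = 0)
    (p15 : ∀ a b c d e, a + b + c + d + e = 1 →
      m (a + 1) (b + 1) c (d + 1) e + m (a + 1) b (c + 1) (d + 1) e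
        - m (a + 1) b (c + 1) d (e + 1) + m (a + 1) b c (d + 1) (e + 1)
        + m a (b + 2) c d (e + 1) = 0)
    (p16 : ∀ a b c d e, a + b + c + d + e = 1 →
      m (a + 1) (b + 1) c (d + 1) e + m a (b + 3) c d e + m a (b + 1) c (d + 1) (e + 1)
        + m a b (c + 2) (d + 1) e - m (a + 1) (b + 1) (c + 1) d e = 0)
    (p17 : ∀ a b c d e, a + b + c + d + e = 1 →
      m (a + 2) b (c + 1) d e - m (a + 2) b c d (e + 1) - m (a + 1) b (c + 1) (d + 1) e
        + m (a + 1) b c (d + 2) e + m a (b + 2) c (d + 1) e = 0)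
    (p23 : ∀ a b c d e, a + b + c + d + e = 1 →
      m (a + 2) b (c + 1) d e + m (a + 1) b (c + 1) d (e + 1) + m (a + 1) b c (d + 2) e
        - m (a + 2) (b + 1) c d e - m (a + 2) b c d (e + 1) - m a (b + 1) (c + 1) (d + 1) e = 0)
    (p24 : ∀ a b c d e, a + b + c + d + e = 1 →
      m (a + 1) b (c + 1) (d + 1) e + m a b c d (e + 3) - m (a + 1) (b + 1) c d (e + 1)
        - m a (b + 1) (c + 2) d e = 0)
    (p25 : ∀ a b c d e, a + b + c + d + e = 1 →
      m (a + 2) (b + 1) c d e + m (a + 2) b (c + 1) d e + m (a + 1) (b + 1) c d (e + 1)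
        + m a b c (d + 1) (e + 2) = 0)
    (p26 : ∀ a b c d e, a + b + c + d + e = 1 →
      m (a + 1) (b + 2) c d e + m (a + 1) (b + 1) c d (e + 1) + m (a + 1) b (c + 2) d e
        + m a (b + 1) c (d + 1) (e + 1) = 0)
    (p27 : ∀ a b c d e, a + b + c + d + e = 1 →
      m (a + 1) (b + 1) c (d + 1) e + m (a + 1) b (c + 1) d (e + 1) - m (a + 1) b c d (e + 2)
        + m a (b + 1) (c + 1) d (e + 1) + m a b (c + 3) d e + m a b c (d + 2) (e + 1) = 0)
    (p34 : ∀ a b c d e, a + b + c + d + e = 1 →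
      m (a + 1) (b + 1) c (d + 1) e - m (a + 1) b c (d + 2) e - m a (b + 2) (c + 1) d e
        - m a b (c + 1) (d + 1) (e + 1) = 0)
    (p35 : ∀ a b c d e, a + b + c + d + e = 1 →
      m (a + 3) b c d e + m (a + 2) (b + 1) c d e - m (a + 2) b c (d + 1) e
        + m (a + 2) b c d (e + 1) - m a b (c + 1) (d + 2) e = 0)
    (p36 : ∀ a b c d e, a + b + c + d + e = 1 →
      m (a + 2) (b + 1) c d e + m (a + 2) b c d (e + 1) + m (a + 1) (b + 1) (c + 1) d e
        - m (a + 1) b (c + 1) (d + 1) e = 0)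
    (p37 : ∀ a b c d e, a + b + c + d + e = 1 →
      m (a + 2) b c (d + 1) e + m (a + 1) b (c + 1) d (e + 1) + m a (b + 1) (c + 2) d e = 0)
    (p45 : ∀ a b c d e, a + b + c + d + e = 1 →
      m (a + 3) b c d e + m (a + 2) b c d (e + 1) - m (a + 1) b c (d + 1) (e + 1)
        - m a (b + 1) c d (e + 2) - m a b (c + 2) (d + 1) e = 0)
    (p46 : ∀ a b c d e, a + b + c + d + e = 1 →
      m (a + 2) (b + 1) c d e + m (a + 2) b c d (e + 1) - m a (b + 2) c d (e + 1)
        - m a b c (d + 1) (e + 2) = 0)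
    (p47 : ∀ a b c d e, a + b + c + d + e = 1 →
      m (a + 2) b c (d + 1) e + m (a + 1) b (c + 1) d (e + 1) - m a (b + 1) c (d + 1) (e + 1) = 0)
    (p56 : ∀ a b c d e, a + b + c + d + e = 1 →
      m (a + 2) b c (d + 1) e + m (a + 1) (b + 2) c d e - m (a + 2) b (c + 1) d e
        - m (a + 1) (b + 1) c (d + 1) e - m a b c (d + 2) (e + 1) = 0)
    (p57 : ∀ a b c d e, a + b + c + d + e = 1 →
      m (a + 3) b c d e - m (a + 2) b c d (e + 1) - m (a + 1) (b + 1) c d (e + 1)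
        - m (a + 1) b (c + 2) d e + m (a + 1) b (c + 1) (d + 1) e + m a (b + 2) (c + 1) d e = 0)
    (p67 : ∀ a b c d e, a + b + c + d + e = 1 →
      m (a + 2) b (c + 1) d e - m (a + 1) b c d (e + 2) - m a (b + 1) (c + 1) d (e + 1) = 0)
    {a b c d e : ℕ} (h : a + b + c + d + e = 4) : m a b c d e = 0 := by
  have m01120 : m 0 1 1 2 0 = 0 := by
    linear_combination (norm := ring_nf) 1/2 * p47 0 0 0 0 1 rfl + 1/2 * p25 1 0 0 0 0 rfl
      + 1/2 * p07 0 0 0 0 1 rfl + 1/2 * p47 0 0 1 0 0 rfl + 1/2 * p06 0 1 0 0 0 rfl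
      + p25 0 1 0 0 0 rfl - 1/2 * p01 0 0 0 0 1 rfl - 1/2 * p37 0 1 0 0 0 rfl
      - 1/2 * p34 0 0 1 0 0 rfl - 1/2 * p14 1 0 0 0 0 rfl - p35 0 1 0 0 0 rfl
      - 1/2 * p67 1 0 0 0 0 rfl - 1/2 * p26 0 0 0 1 0 rfl - 1/2 * p47 1 0 0 0 0 rfl
      - 1/2 * p15 1 0 0 0 0 rfl - 1/2 * p12 0 0 0 1 0 rfl - 1/2 * p03 1 0 0 0 0 rfl
  have m00022 : m 0 0 0 2 2 = 0 := by
    linear_combination (norm := ring_nf) p01 1 0 0 0 0 rfl + p01 0 0 1 0 0 rfl + p07 0 0 0 0 1 rfl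
      + p25 0 0 0 1 0 rfl + p34 0 0 0 1 0 rfl + p06 0 0 0 1 0 rfl + p23 0 0 0 1 0 rfl + 2 * m01120
      - p46 0 0 0 1 0 rfl - p04 0 1 0 0 0 rfl - p06 1 0 0 0 0 rfl - p01 0 0 0 0 1 rfl
      - p07 0 1 0 0 0 rfl - p67 1 0 0 0 0 rfl - p67 0 0 0 1 0 rfl - p04 0 0 0 0 1 rfl
      - p46 0 0 0 0 1 rfl - p25 0 0 0 0 1 rfl - p07 1 0 0 0 0 rfl - p06 0 1 0 0 0 rfl
      - p26 0 1 0 0 0 rfl - p12 0 1 0 0 0 rfl - p67 0 0 1 0 0 rfl - p05 0 1 0 0 0 rfl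
  have m00211 : m 0 0 2 1 1 = 0 := by
    linear_combination (norm := ring_nf) p04 0 0 0 0 1 rfl - p03 0 0 0 0 1 rfl - m00022
  have m03001 : m 0 3 0 0 1 = 0 := by
    linear_combination (norm := ring_nf) p16 0 0 0 0 1 rfl - p05 0 1 0 0 0 rfl - p14 0 1 0 0 0 rfl
      + p07 1 0 0 0 0 rfl + p25 0 0 1 0 0 rfl + p01 1 0 0 0 0 rfl - p02 0 0 0 1 0 rfl
      + p56 0 0 0 0 1 rfl - p25 0 1 0 0 0 rfl - m00211 + m01120 + m00022
  have m12100 : m 1 2 1 0 0 = 0 := by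
    linear_combination (norm := ring_nf) p07 0 0 1 0 0 rfl + p06 0 0 0 0 1 rfl + p26 0 0 1 0 0 rfl
      + p46 0 1 0 0 0 rfl + p47 0 0 1 0 0 rfl + p14 0 1 0 0 0 rfl + p01 0 0 0 0 1 rfl
      + p35 0 0 1 0 0 rfl + p06 1 0 0 0 0 rfl + p16 0 0 0 1 0 rfl + m03001 - p01 0 0 1 0 0 rfl
      - p25 0 0 1 0 0 rfl - p07 1 0 0 0 0 rfl - p47 0 0 0 0 1 rfl - p17 0 1 0 0 0 rfl - 2 * m01120
  have m12010 : m 1 2 0 1 0 = 0 := by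
    linear_combination (norm := ring_nf) p36 0 1 0 0 0 rfl + m00211 - p12 0 0 0 1 0 rfl
      - p46 0 1 0 0 0 rfl - m12100 - m03001
  have m11101 : m 1 1 1 0 1 = 0 := by
    linear_combination (norm := ring_nf) p04 0 1 0 0 0 rfl + p47 0 0 0 0 1 rfl - p26 0 0 0 1 0 rfl
      - p02 1 0 0 0 0 rfl - p46 0 1 0 0 0 rfl + p34 0 0 0 0 1 rfl - p07 0 0 0 1 0 rfl
      - p67 0 1 0 0 0 rfl - p14 0 1 0 0 0 rfl + p25 0 0 1 0 0 rfl + p07 1 0 0 0 0 rfl + m12010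
      - m03001 + m01120
  have m20011 : m 2 0 0 1 1 = 0 := by
    linear_combination (norm := ring_nf) m11101 - p03 0 0 0 0 1 rfl - m00211
  have m20200 : m 2 0 2 0 0 = 0 := by
    linear_combination (norm := ring_nf) m00211 - p06 0 0 1 0 0 rfl - m11101
  have m04000 : m 0 4 0 0 0 = 0 := by
    linear_combination (norm := ring_nf) p16 0 1 0 0 0 rfl + p03 0 1 0 0 0 rfl + p47 0 1 0 0 0 rfl
      - m12010 - m11101
  have m01111 : m 0 1 1 1 1 = 0 := by
    linear_combination (norm := ring_nf) p02 1 0 0 0 0 rfl - p47 0 0 0 0 1 rfl + p25 1 0 0 0 0 rfl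
      - p67 1 0 0 0 0 rfl - p35 0 0 0 0 1 rfl - p05 0 0 0 0 1 rfl - p14 0 0 0 0 1 rfl
      - p35 0 1 0 0 0 rfl + p46 0 1 0 0 0 rfl - m12100 - m11101 - m01120 + m03001
  have m10300 : m 1 0 3 0 0 = 0 := by
    linear_combination (norm := ring_nf) p26 0 0 1 0 0 rfl - m12100 - m01111 - m11101
  have m10111 : m 1 0 1 1 1 = 0 := by
    linear_combination (norm := ring_nf) -p07 0 0 1 0 0 rfl - m10300
  have m01300 : m 0 1 3 0 0 = 0 := by
    linear_combination (norm := ring_nf) p37 0 0 1 0 0 rfl - p47 0 0 1 0 0 rfl - m01111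
  have m02101 : m 0 2 1 0 1 = 0 := by
    linear_combination (norm := ring_nf) p46 0 1 0 0 0 rfl + p14 0 1 0 0 0 rfl + p27 0 1 0 0 0 rfl
      + p01 0 0 0 0 1 rfl - p47 0 0 0 0 1 rfl + m03001 - m01120 - m12010 - m01300 - m11101
      + m20011
  have m11011 : m 1 1 0 1 1 = 0 := by
    linear_combination (norm := ring_nf) p01 0 0 1 0 0 rfl + p67 0 1 0 0 0 rfl + p25 0 0 0 1 0 rfl
      - p47 0 0 1 0 0 rfl - p27 0 1 0 0 0 rfl + p04 0 1 0 0 0 rfl + m01120 + 2 * m02101 - m00022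
      - m01111 + m12010 + m01300 + m11101 - m12100
  have m11200 : m 1 1 2 0 0 = 0 := by
    linear_combination (norm := ring_nf) -p07 0 1 0 0 0 rfl - m11011
  have m11110 : m 1 1 1 1 0 = 0 := by
    linear_combination (norm := ring_nf) p15 0 1 0 0 0 rfl - m03001 + m11101 - m11011 - m12010
  have m01012 : m 0 1 0 1 2 = 0 := by
    linear_combination (norm := ring_nf) p16 0 0 0 0 1 rfl - m03001 + m11101 - m00211 - m11011
  have m10102 : m 1 0 1 0 2 = 0 := by
    linear_combination (norm := ring_nf) p47 0 0 0 0 1 rfl - m20011 + m01012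
  have m01201 : m 0 1 2 0 1 = 0 := by
    linear_combination (norm := ring_nf) m20200 - p67 0 0 1 0 0 rfl - m10102
  have m10003 : m 1 0 0 0 3 = 0 := by
    linear_combination (norm := ring_nf) p12 0 0 1 0 0 rfl - p27 0 0 0 0 1 rfl + m11200 + m12100
      + m11011 + m00022 + m10102
  have m22000 : m 2 2 0 0 0 = 0 := by
    linear_combination (norm := ring_nf) p25 0 1 0 0 0 rfl + p06 0 1 0 0 0 rfl - m01012 - m01111
  have m02020 : m 0 2 0 2 0 = 0 := by
    linear_combination (norm := ring_nf) m11101 - p01 0 1 0 0 0 rfl - m22000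
  have m11002 : m 1 1 0 0 2 = 0 := by
    linear_combination (norm := ring_nf) p14 0 1 0 0 0 rfl - m01120 + m22000
  have m00004 : m 0 0 0 0 4 = 0 := by
    linear_combination (norm := ring_nf) p24 0 0 0 0 1 rfl + m01201 - m10111 + m11002
  have m21001 : m 2 1 0 0 1 = 0 := by
    linear_combination (norm := ring_nf) p26 1 0 0 0 0 rfl - m22000 - m20200 - m11011
  have m01021 : m 0 1 0 2 1 = 0 := by
    linear_combination (norm := ring_nf) p27 0 1 0 0 0 rfl - m12010 - m01300 + m11002 - m02101
      - m11101
  have m20002 : m 2 0 0 0 2 = 0 := by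
    linear_combination (norm := ring_nf) p36 0 0 0 0 1 rfl - m21001 + m10111 - m11101
  have m20020 : m 2 0 0 2 0 = 0 := by
    linear_combination (norm := ring_nf) p47 0 0 0 1 0 rfl + m01021 - m10111
  have m30100 : m 3 0 1 0 0 = 0 := by
    linear_combination (norm := ring_nf) p67 1 0 0 0 0 rfl + m11101 + m20002
  have m21100 : m 2 1 1 0 0 = 0 := by
    linear_combination (norm := ring_nf) p67 0 1 0 0 0 rfl + m02101 + m11002
  have m10201 : m 1 0 2 0 1 = 0 := by
    linear_combination (norm := ring_nf) p01 0 0 1 0 0 rfl + m21100 + m01120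
  have m21010 : m 2 1 0 1 0 = 0 := by
    linear_combination (norm := ring_nf) m10102 + m12100 - p02 1 0 0 0 0 rfl - m21001
  have m00103 : m 0 0 1 0 3 = 0 := by
    linear_combination (norm := ring_nf) p02 0 0 0 0 1 rfl + m11002 - m02101 + m11011
  have m01210 : m 0 1 2 1 0 = 0 := by
    linear_combination (norm := ring_nf) m12100 - p03 0 1 0 0 0 rfl - m21010
  have m00220 : m 0 0 2 2 0 = 0 := by
    linear_combination (norm := ring_nf) m11110 - p03 0 0 0 1 0 rfl - m20020
  have m00031 : m 0 0 0 3 1 = 0 := by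
    linear_combination (norm := ring_nf) p04 0 0 0 1 0 rfl - m11110 + m20020
  have m40000 : m 4 0 0 0 0 = 0 := by
    linear_combination (norm := ring_nf) m20011 - p05 1 0 0 0 0 rfl - m20002 - m11110
  have m12001 : m 1 2 0 0 1 = 0 := by
    linear_combination (norm := ring_nf) m01111 - p06 0 1 0 0 0 rfl - m21100
  have m10012 : m 1 0 0 1 2 = 0 := by
    linear_combination (norm := ring_nf) -p07 0 0 0 0 1 rfl - m10201
  have m01102 : m 0 1 1 0 2 = 0 := by
    linear_combination (norm := ring_nf) p13 0 0 0 0 1 rfl + m12001 - m00031 - m10003 + m10012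
      + m21001 - m10111
  have m00130 : m 0 0 1 3 0 = 0 := by
    linear_combination (norm := ring_nf) p14 0 0 0 1 0 rfl - m10012 + m21010
  have m00121 : m 0 0 1 2 1 = 0 := by
    linear_combination (norm := ring_nf) p14 0 0 0 0 1 rfl - m10003 + m21001
  have m10210 : m 1 0 2 1 0 = 0 := by
    linear_combination (norm := ring_nf) p15 0 0 1 0 0 rfl - m02101 + m10201 - m10111 - m11110
  have m02002 : m 0 2 0 0 2 = 0 := by
    linear_combination (norm := ring_nf) p15 0 0 0 0 1 rfl + m10102 - m10111 - m10012 - m11011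
  have m13000 : m 1 3 0 0 0 = 0 := by
    linear_combination (norm := ring_nf) p16 1 0 0 0 0 rfl + m21100 - m10210 - m21010 - m11011
  have m02011 : m 0 2 0 1 1 = 0 := by
    linear_combination (norm := ring_nf) p16 0 1 0 0 0 rfl - m04000 + m12100 - m01210 - m12010
  have m20110 : m 2 0 1 1 0 = 0 := by
    linear_combination (norm := ring_nf) p24 1 0 0 0 0 rfl + m11200 - m10003 + m21001
  have m31000 : m 3 1 0 0 0 = 0 := by
    linear_combination (norm := ring_nf) p25 1 0 0 0 0 rfl - m21001 - m30100 - m10012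
  have m00112 : m 0 0 1 1 2 = 0 := by
    linear_combination (norm := ring_nf) p25 0 0 1 0 0 rfl - m11101 - m20200 - m21100
  have m00400 : m 0 0 4 0 0 = 0 := by
    linear_combination (norm := ring_nf) p27 0 0 1 0 0 rfl - m11110 - m00121 + m10102 - m01201
      - m10201
  have m00301 : m 0 0 3 0 1 = 0 := by
    linear_combination (norm := ring_nf) p27 0 0 0 0 1 rfl - m11011 - m00022 + m10003 - m01102
      - m10102
  have m10021 : m 1 0 0 2 1 = 0 := by
    linear_combination (norm := ring_nf) m11011 - p34 0 0 0 0 1 rfl - m02101 - m00112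
  have m20101 : m 2 0 1 0 1 = 0 := by
    linear_combination (norm := ring_nf) p35 0 0 1 0 0 rfl + m20110 - m21100 + m00220 - m30100
  have m30010 : m 3 0 0 1 0 = 0 := by
    linear_combination (norm := ring_nf) p35 0 0 0 1 0 rfl - m20011 + m20020 - m21010 + m00130
  have m30001 : m 3 0 0 0 1 = 0 := by
    linear_combination (norm := ring_nf) p35 0 0 0 0 1 rfl - m20002 + m20011 - m21001 + m00121
  have m10120 : m 1 0 1 2 0 = 0 := by
    linear_combination (norm := ring_nf) m21010 + m11110 + m20011 - p36 0 0 0 1 0 rfl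
  have m02200 : m 0 2 2 0 0 = 0 := by
    linear_combination (norm := ring_nf) p37 0 1 0 0 0 rfl - m21010 - m11101
  have m00310 : m 0 0 3 1 0 = 0 := by
    linear_combination (norm := ring_nf) m20101 + m30100 - p45 0 0 1 0 0 rfl - m01102 - m10111
  have m01003 : m 0 1 0 0 3 = 0 := by
    linear_combination (norm := ring_nf) m20002 + m30001 - p45 0 0 0 0 1 rfl - m00211 - m10012
  have m00013 : m 0 0 0 1 3 = 0 := by
    linear_combination (norm := ring_nf) m21001 + m20002 - p46 0 0 0 0 1 rfl - m02002
  have m11020 : m 1 1 0 2 0 = 0 := by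
    linear_combination (norm := ring_nf) m12010 + m20020 - p56 0 0 0 1 0 rfl - m20110 - m00031
  have m03100 : m 0 3 1 0 0 = 0 := by
    linear_combination (norm := ring_nf) p57 0 1 0 0 0 rfl - m31000 + m12001 + m11200 - m11110
      + m21001
  have m02110 : m 0 2 1 1 0 = 0 := by
    linear_combination (norm := ring_nf) p57 0 0 0 1 0 rfl - m30010 + m11011 + m10210 - m10120
      + m20011
  have m01030 : m 0 1 0 3 0 = 0 := by
    linear_combination (norm := ring_nf) m10111 - p01 0 0 0 1 0 rfl - m21010
  have m00202 : m 0 0 2 0 2 = 0 := by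
    linear_combination (norm := ring_nf) p02 0 0 1 0 0 rfl + m11101 - m02200 + m11110
  have m10030 : m 1 0 0 3 0 = 0 := by
    linear_combination (norm := ring_nf) p13 1 0 0 0 0 rfl - m11101 + m22000 - m20002 + m20011
      + m31000 - m20110
  have m00040 : m 0 0 0 4 0 = 0 := by
    linear_combination (norm := ring_nf) p13 0 0 0 1 0 rfl - m01111 + m12010 - m10012 + m10021
      + m21010 - m10120
  have m03010 : m 0 3 0 1 0 = 0 := by
    linear_combination (norm := ring_nf) p16 0 0 0 1 0 rfl + m11110 - m00220 - m11020 - m01021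
  have ha : a ≤ 4 := by lia
  have hb : b ≤ 4 := by lia
  have hc : c ≤ 4 := by lia
  have hd : d ≤ 4 := by lia
  obtain rfl : e = 4 - a - b - c - d := by lia
  interval_cases a <;> interval_cases b <;> interval_cases c <;> interval_cases d <;>
    first | assumption | (simp at h)

theorem M₀_skew (i j : Fin 8) : M₀ j i = -M₀ i j := by
  fin_cases i <;> fin_cases j <;> simp [M₀]

theorem exists_X_eq_of_sum_eq_one {a b c d e : ℕ} (h : a + b + c + d + e = 1) :
    ∃ k : Fin 5, (X k : P5) = x1 ^ a * x2 ^ b * x3 ^ c * x4 ^ d * x5 ^ e := by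
  obtain ⟨rfl, rfl, rfl, rfl, rfl⟩ | ⟨rfl, rfl, rfl, rfl, rfl⟩ | ⟨rfl, rfl, rfl, rfl, rfl⟩ |
      ⟨rfl, rfl, rfl, rfl, rfl⟩ | ⟨rfl, rfl, rfl, rfl, rfl⟩ :
      (a = 1 ∧ b = 0 ∧ c = 0 ∧ d = 0 ∧ e = 0) ∨ (a = 0 ∧ b = 1 ∧ c = 0 ∧ d = 0 ∧ e = 0) ∨
      (a = 0 ∧ b = 0 ∧ c = 1 ∧ d = 0 ∧ e = 0) ∨ (a = 0 ∧ b = 0 ∧ c = 0 ∧ d = 1 ∧ e = 0) ∨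
      (a = 0 ∧ b = 0 ∧ c = 0 ∧ d = 0 ∧ e = 1) := by omega
  exacts [⟨0, by simp⟩, ⟨1, by simp⟩, ⟨2, by simp⟩, ⟨3, by simp⟩, ⟨4, by simp⟩]

set_option maxHeartbeats 2000000 in
/-- A linear functional that annihilates the products `xₖ · Pf_{ij}(M₀)` annihilates all monomials
of degree four. -/
theorem map_monomial_eq_zero (φ : P5 →ₗ[ℂ] ℂ)
    (hφ : ∀ (k : Fin 5) (f : Fin 6 → Fin 8), StrictMono f →
      φ (X k * pfaffian (n := 3) (M₀.submatrix f f)) = 0)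
    {a b c d e : ℕ} (h : a + b + c + d + e = 4) :
    φ (x1 ^ a * x2 ^ b * x3 ^ c * x4 ^ d * x5 ^ e) = 0 := by
  have key (f : Fin 6 → Fin 8) (hf : StrictMono f) {a b c d e : ℕ} (h : a + b + c + d + e = 1)
      {q : P5} (hq : q = x1 ^ a * x2 ^ b * x3 ^ c * x4 ^ d * x5 ^ e *
        pfaffian (n := 3) (M₀.submatrix f f)) : φ q = 0 := by
    obtain ⟨k, hk⟩ := exists_X_eq_of_sum_eq_one h
    rw [hq, ← hk, hφ k f hf]
  have hpf (f : Fin 6 → Fin 8) := pfaffian_six (M₀.submatrix f f) fun i j => M₀_skew (f i) (f j)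
  refine eq_zero_of_cubic_relations
    (fun a b c d e => φ (x1 ^ a * x2 ^ b * x3 ^ c * x4 ^ d * x5 ^ e))
    ?_ ?_ ?_ ?_ ?_ ?_ ?_ ?_ ?_ ?_ ?_ ?_ ?_ ?_ ?_ ?_ ?_ ?_ ?_ ?_ ?_ ?_ ?_ ?_ ?_ ?_ ?_ ?_ h <;>
    intro a b c d e h <;> simp only [← map_add, ← map_sub, ← map_neg]
  · exact key ![2, 3, 4, 5, 6, 7] (by decide) h (by rw [hpf]; simp [M₀]; ring)
  · exact key ![1, 3, 4, 5, 6, 7] (by decide) h (by rw [hpf]; simp [M₀]; ring)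
  · exact key ![1, 2, 4, 5, 6, 7] (by decide) h (by rw [hpf]; simp [M₀]; ring)
  · exact key ![1, 2, 3, 5, 6, 7] (by decide) h (by rw [hpf]; simp [M₀]; ring)
  · exact key ![1, 2, 3, 4, 6, 7] (by decide) h (by rw [hpf]; simp [M₀]; ring)
  · exact key ![1, 2, 3, 4, 5, 7] (by decide) h (by rw [hpf]; simp [M₀]; ring)
  · exact key ![1, 2, 3, 4, 5, 6] (by decide) h (by rw [hpf]; simp [M₀]; ring)
  · exact key ![0, 3, 4, 5, 6, 7] (by decide) h (by rw [hpf]; simp [M₀]; ring)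
  · exact key ![0, 2, 4, 5, 6, 7] (by decide) h (by rw [hpf]; simp [M₀]; ring)
  · exact key ![0, 2, 3, 5, 6, 7] (by decide) h (by rw [hpf]; simp [M₀]; ring)
  · exact key ![0, 2, 3, 4, 6, 7] (by decide) h (by rw [hpf]; simp [M₀]; ring)
  · exact key ![0, 2, 3, 4, 5, 7] (by decide) h (by rw [hpf]; simp [M₀]; ring)
  · exact key ![0, 2, 3, 4, 5, 6] (by decide) h (by rw [hpf]; simp [M₀]; ring)
  · exact key ![0, 1, 4, 5, 6, 7] (by decide) h (by rw [hpf]; simp [M₀]; ring)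
  · exact key ![0, 1, 3, 5, 6, 7] (by decide) h (by rw [hpf]; simp [M₀]; ring)
  · exact key ![0, 1, 3, 4, 6, 7] (by decide) h (by rw [hpf]; simp [M₀]; ring)
  · exact key ![0, 1, 3, 4, 5, 7] (by decide) h (by rw [hpf]; simp [M₀]; ring)
  · exact key ![0, 1, 3, 4, 5, 6] (by decide) h (by rw [hpf]; simp [M₀]; ring)
  · exact key ![0, 1, 2, 5, 6, 7] (by decide) h (by rw [hpf]; simp [M₀]; ring)
  · exact key ![0, 1, 2, 4, 6, 7] (by decide) h (by rw [hpf]; simp [M₀]; ring)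
  · exact key ![0, 1, 2, 4, 5, 7] (by decide) h (by rw [hpf]; simp [M₀]; ring)
  · exact key ![0, 1, 2, 4, 5, 6] (by decide) h (by rw [hpf]; simp [M₀]; ring)
  · exact key ![0, 1, 2, 3, 6, 7] (by decide) h (by rw [hpf]; simp [M₀]; ring)
  · exact key ![0, 1, 2, 3, 5, 7] (by decide) h (by rw [hpf]; simp [M₀]; ring)
  · exact key ![0, 1, 2, 3, 5, 6] (by decide) h (by rw [hpf]; simp [M₀]; ring)
  · exact key ![0, 1, 2, 3, 4, 7] (by decide) h (by rw [hpf]; simp [M₀]; ring)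
  · exact key ![0, 1, 2, 3, 4, 6] (by decide) h (by rw [hpf]; simp [M₀]; ring)
  · exact key ![0, 1, 2, 3, 4, 5] (by decide) h (by rw [hpf]; simp [M₀]; ring)

/-- The 140 quartics `xₖ · Pf_{ij}(M₀)` span the space of
quinary quartics: for `0 ≤ i < j ≤ 7`, deleting the `i`-th and `j`-th rows and
columns of `M₀` (equivalently, restricting `M₀` along a strictly monotone map
`f : Fin 6 → Fin 8` whose image is the complement of `{i, j}`) yields a `6×6`
skew-symmetric matrix whose Pfaffian `Pf_{ij}(M₀)` is a homogeneous cubic, and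
the products `xₖ · Pf_{ij}(M₀)` (`1 ≤ k ≤ 5`) span the full 70-dimensional
space of homogeneous quartic polynomials in `x₁, …, x₅`.  (This is the
surjectivity of the differential at `M₀` of the Pfaffian map from `8×8`
skew-symmetric matrices of linear forms to quinary quartics.) -/
theorem deriv_pfaffian_surjective_at_M₀ :
    ∀ q : P5, q.IsHomogeneous 4 →
      q ∈ Submodule.span ℂ
        {g : P5 | ∃ (k : Fin 5) (f : Fin 6 → Fin 8), StrictMono f ∧
          g = X k * pfaffian (n := 3) (M₀.submatrix f f)} := by
  intro q hq
  by_contra hmem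
  obtain ⟨φ, hφq, hφ⟩ := Submodule.exists_le_ker_of_notMem hmem
  refine hφq ?_
  rw [q.as_sum, map_sum]
  refine Finset.sum_eq_zero fun s hs => ?_
  have hdeg : s 0 + s 1 + s 2 + s 3 + s 4 = 4 := by
    rw [← Fin.sum_univ_five s, ← Finsupp.degree_eq_sum, ← hq (mem_support_iff.mp hs)]
    exact DFunLike.congr_fun Finsupp.degree_eq_weight_one s
  have hmon : monomial s (coeff s q) =
      coeff s q • (x1 ^ s 0 * x2 ^ s 1 * x3 ^ s 2 * x4 ^ s 3 * x5 ^ s 4) := by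
    rw [monomial_eq, Finsupp.prod_fintype _ _ (by simp), Fin.prod_univ_five, smul_eq_C_mul]
  rw [hmon, map_smul, map_monomial_eq_zero φ (fun k f hf => ?_) hdeg, smul_zero]
  exact hφ (Submodule.subset_span ⟨k, f, hf, rfl⟩)
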